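/- Let n ≥ 1, let m be a natural number, and let U be a nonempty open subset of ℝⁿ. Then every morphism of sheaves u : C^m → C^m over U is multiplication by a unique function of class C^m: there exists a unique g ∈ C^m(U) such that for every open V ⊆ U, every φ ∈ C^m(V) and every x ∈ V one has u_V(φ)(x) = g(x) · φ(x). (Hence the sheaf Hom of C^m into itself is isomorphic to C^m.) -/

import Mathlib

open scoped BigOperators

/-- The partial derivative in the `i`-th coordinate direction. -/
noncomputable def pderivE (n : ℕ) (i : Fin n) (f : EuclideanSpace ℝ (Fin n) → ℝ) :
    EuclideanSpace ℝ (Fin n) → ℝ :=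
  fun x => fderiv ℝ f x (EuclideanSpace.single i 1)

/-- The iterated partial derivative `∂^α` for a multi-index `α : Fin n → ℕ`. -/
noncomputable def partialD (n : ℕ) (α : Fin n → ℕ) (f : EuclideanSpace ℝ (Fin n) → ℝ) :
    EuclideanSpace ℝ (Fin n) → ℝ :=
  (List.finRange n).foldr (fun i g => (pderivE n i)^[α i] g) f

/-- The finset of multi-indices `α : Fin n → ℕ` of length `|α| = ∑ i, α i ≤ k`. -/
def multiIdx (n k : ℕ) : Finset (Fin n → ℕ) :=
  (Finset.Iic fun _ : Fin n => k).filter fun α => (∑ i, α i) ≤ k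

/-- A morphism of sheaves `C^m → C^r` over the open set `U ⊆ ℝⁿ`:  a family of
`ℝ`-linear maps `C^m(V) → C^r(V)`, for open `V ⊆ U`, commuting with restriction.
Sections of `C^k` over `V` are represented by total functions that are `C^k` on `V`;
`restrict` encodes both compatibility with restriction and the fact that `app V f`
only depends on `f|_V`. -/
structure SheafHom (n m r : ℕ) (U : Set (EuclideanSpace ℝ (Fin n))) where
  app : Set (EuclideanSpace ℝ (Fin n)) → (EuclideanSpace ℝ (Fin n) → ℝ) →
    (EuclideanSpace ℝ (Fin n) → ℝ)
  map_contDiffOn : ∀ V, V ⊆ U → IsOpen V → ∀ f, ContDiffOn ℝ (m : ℕ∞) f V →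
    ContDiffOn ℝ (r : ℕ∞) (app V f) V
  map_add : ∀ V, V ⊆ U → IsOpen V → ∀ f g, ContDiffOn ℝ (m : ℕ∞) f V →
    ContDiffOn ℝ (m : ℕ∞) g V → ∀ x ∈ V, app V (f + g) x = app V f x + app V g x
  map_smul : ∀ V, V ⊆ U → IsOpen V → ∀ (c : ℝ) f, ContDiffOn ℝ (m : ℕ∞) f V →
    ∀ x ∈ V, app V (c • f) x = c * app V f x
  restrict : ∀ V, V ⊆ U → IsOpen V → ∀ W, W ⊆ V → IsOpen W →
    ∀ f g, ContDiffOn ℝ (m : ℕ∞) f V → ContDiffOn ℝ (m : ℕ∞) g W →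
    (∀ x ∈ W, f x = g x) → ∀ x ∈ W, app V f x = app W g x

open Filter Topology

lemma aux_zero_of_freq {X : Type*} [TopologicalSpace X] {h : X → ℝ} {s : X}
    (hc : ContinuousAt h s) (hf : ∃ᶠ t in 𝓝 s, h t = 0) : h s = 0 := by
  by_contra hne
  exact hf (hc.eventually_ne hne)

lemma aux_pos_contDiff (m : ℕ) : ContDiff ℝ (m : ℕ∞) (fun s : ℝ => (max s 0) ^ (m + 1)) := by
  induction m with
  | zero =>
    simp only [Nat.cast_zero, zero_add, pow_one]
    exact contDiff_zero.2 (by fun_prop)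
  | succ k ih =>
    have hd : ∀ s : ℝ, HasDerivAt (fun s : ℝ => (max s 0) ^ (k + 1 + 1))
        (((k : ℝ) + 2) * (max s 0) ^ (k + 1)) s := by
      intro s
      rcases lt_trichotomy s 0 with h | h | h
      · have : (fun s : ℝ => (max s 0) ^ (k + 1 + 1)) =ᶠ[𝓝 s] fun _ => 0 := by
          filter_upwards [Iio_mem_nhds h] with t ht
          rw [max_eq_right (le_of_lt ht)]; simp
        rw [max_eq_right h.le]
        simpa using (hasDerivAt_const s (0 : ℝ)).congr_of_eventuallyEq this
      · subst h
        simp only [max_self, ne_eq, Nat.add_eq_zero_iff, one_ne_zero, and_false, not_false_eq_true,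
          zero_pow, mul_zero]
        rw [hasDerivAt_iff_isLittleO_nhds_zero]
        simp only [zero_add, max_self, ne_eq, Nat.add_eq_zero_iff, one_ne_zero, and_false,
          not_false_eq_true, zero_pow, sub_zero, smul_zero]
        have h1 : (fun h : ℝ => (max h 0) ^ (k + 1 + 1)) =O[𝓝 0] fun h : ℝ => h ^ (k + 2) := by
          refine Asymptotics.IsBigO.of_bound 1 (Eventually.of_forall fun t => ?_)
          rw [norm_pow, norm_pow, one_mul]
          gcongr
          rw [Real.norm_eq_abs, Real.norm_eq_abs, abs_of_nonneg (le_max_right _ _)]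
          exact max_le (le_abs_self _) (abs_nonneg _)
        refine h1.trans_isLittleO ?_
        simpa using Asymptotics.isLittleO_pow_pow (𝕜 := ℝ) (show 1 < k + 2 by omega)
      · have : (fun s : ℝ => (max s 0) ^ (k + 1 + 1)) =ᶠ[𝓝 s] fun s => s ^ (k + 1 + 1) := by
          filter_upwards [Ioi_mem_nhds h] with t ht
          rw [max_eq_left (le_of_lt ht)]
        rw [max_eq_left h.le]
        have h2 := (hasDerivAt_pow (k + 1 + 1) s).congr_of_eventuallyEq this
        refine h2.congr_deriv ?_
        have e : k + 1 + 1 - 1 = k + 1 := by omega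
        rw [e]
        push_cast
        ring
    have : (((k + 1 : ℕ) : ℕ∞) : WithTop ℕ∞) = ((k : ℕ∞) : WithTop ℕ∞) + 1 := by
      norm_cast
    rw [this, contDiff_succ_iff_deriv]
    refine ⟨fun s => (hd s).differentiableAt, fun h => by simp at h, ?_⟩
    have : deriv (fun s : ℝ => (max s 0) ^ (k + 1 + 1)) =
        fun s => ((k : ℝ) + 2) * (max s 0) ^ (k + 1) := funext fun s => (hd s).deriv
    rw [this]
    exact contDiff_const.mul ih

/-- The quantity `∑ₖ C(i,k) (-γ)^{i-k} pₖ^{(j)}`. -/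
noncomputable def auxQ (p : ℕ → ℝ → ℝ) (γ : ℝ → ℝ) (i j : ℕ) (s : ℝ) : ℝ :=
  ∑ k ∈ Finset.range (i + 1), (i.choose k : ℝ) * ((-γ s) ^ (i - k) * iteratedDeriv j (p k) s)

lemma aux_iter_cont {m j : ℕ} (hj : j ≤ m) {I : Set ℝ} (hI : IsOpen I) {f : ℝ → ℝ}
    (hf : ContDiffOn ℝ (m : ℕ∞) f I) {s : ℝ} (hs : s ∈ I) :
    ContinuousAt (iteratedDeriv j f) s := by
  have h := hf.continuousOn_iteratedDerivWithin (m := j) (by exact_mod_cast hj) hI.uniqueDiffOn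
  exact (h.congr (iteratedDerivWithin_of_isOpen hI).symm).continuousAt (hI.mem_nhds hs)

lemma aux_iter_diff {m j : ℕ} (hj : j < m) {I : Set ℝ} (hI : IsOpen I) {f : ℝ → ℝ}
    (hf : ContDiffOn ℝ (m : ℕ∞) f I) {s : ℝ} (hs : s ∈ I) :
    HasDerivAt (iteratedDeriv j f) (iteratedDeriv (j + 1) f s) s := by
  have h := hf.differentiableOn_iteratedDerivWithin (m := j) (by exact_mod_cast hj) hI.uniqueDiffOn
  have h2 := (h.congr (iteratedDerivWithin_of_isOpen hI).symm).differentiableAt (hI.mem_nhds hs)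
  rw [iteratedDeriv_succ]
  exact h2.hasDerivAt

lemma auxQ_deriv {m : ℕ} {I : Set ℝ} (hI : IsOpen I) {p : ℕ → ℝ → ℝ} {γ : ℝ → ℝ}
    (hp : ∀ k, ContDiffOn ℝ (m : ℕ∞) (p k) I) {s : ℝ} (hs : s ∈ I) {γ' : ℝ}
    (hγ : HasDerivAt γ γ' s) (i j : ℕ) (hj : j < m) :
    HasDerivAt (auxQ p γ (i + 1) j)
      (auxQ p γ (i + 1) (j + 1) s - ((i : ℝ) + 1) * γ' * auxQ p γ i j s) s := by
  have h1 : ∀ k ∈ Finset.range (i + 1 + 1), HasDerivAt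
      (fun s => ((i + 1).choose k : ℝ) * ((-γ s) ^ (i + 1 - k) * iteratedDeriv j (p k) s))
      (((i + 1).choose k : ℝ) * ((((i + 1 - k : ℕ) : ℝ) * (-γ s) ^ (i + 1 - k - 1) * (-γ')) *
        iteratedDeriv j (p k) s + (-γ s) ^ (i + 1 - k) * iteratedDeriv (j + 1) (p k) s)) s := by
    intro k _
    exact ((hγ.fun_neg.fun_pow (i + 1 - k)).fun_mul (aux_iter_diff hj hI (hp k) hs)).const_mul _
  have h2 := HasDerivAt.fun_sum h1
  refine h2.congr_deriv ?_
  simp only [mul_add, Finset.sum_add_distrib]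
  rw [Finset.sum_range_succ]
  simp only [auxQ, Nat.sub_self, Nat.cast_zero, zero_mul, mul_zero, add_zero]
  rw [Finset.mul_sum, add_comm, sub_eq_add_neg, ← Finset.sum_neg_distrib]
  congr 1
  refine Finset.sum_congr rfl fun k hk => ?_
  have e : i + 1 - k - 1 = i - k := by omega
  have hc : (i.choose k : ℝ) * ((i : ℝ) + 1) = ((i + 1).choose k : ℝ) * ((i + 1 - k : ℕ) : ℝ) := by
    exact_mod_cast Nat.choose_mul_succ_eq i k
  rw [e]
  linear_combination (γ' * (-γ s) ^ (i - k) * iteratedDeriv j (p k) s) * hc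

lemma auxQ_zero {m : ℕ} {I : Set ℝ} (hI : IsOpen I) {p : ℕ → ℝ → ℝ} {γ γ' : ℝ → ℝ}
    (hp : ∀ k, ContDiffOn ℝ (m : ℕ∞) (p k) I)
    (hγ : ∀ s ∈ I, HasDerivAt γ (γ' s) s) (hγ' : ∀ s ∈ I, γ' s ≠ 0)
    (h0 : ∀ s ∈ I, ∀ j ≤ m, auxQ p γ (m + 1) j s = 0) (d : ℕ) (hd : d ≤ m) :
    ∀ s ∈ I, ∀ j ≤ m - d, auxQ p γ (m + 1 - d) j s = 0 := by
  induction d with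
  | zero => simpa using h0
  | succ d ih =>
    intro s hs j hj
    have ih := ih (by omega)
    obtain ⟨i, hi⟩ : ∃ i, i + 1 = m + 1 - d := ⟨m - d, by omega⟩
    rw [← hi] at ih
    have e : m + 1 - (d + 1) = i := by omega
    rw [e]
    have h1 := auxQ_deriv hI hp hs (hγ s hs) i j (by omega)
    have h2 : auxQ p γ (i + 1) j =ᶠ[𝓝 s] fun _ => 0 := by
      filter_upwards [hI.mem_nhds hs] with t ht
      exact ih t ht j (by omega)
    have h3 := h1.unique ((hasDerivAt_const s (0 : ℝ)).congr_of_eventuallyEq h2)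
    rw [ih s hs (j + 1) (by omega)] at h3
    have h4 : (i : ℝ) + 1 ≠ 0 := by positivity
    have h5 : ((i : ℝ) + 1) * γ' s ≠ 0 := mul_ne_zero h4 (hγ' s hs)
    have h6 : ((i : ℝ) + 1) * γ' s * auxQ p γ i j s = 0 := by linarith
    exact (mul_eq_zero.1 h6).resolve_left h5

namespace SheafHom
variable {n m r : ℕ} {U : Set (EuclideanSpace ℝ (Fin n))} (u : SheafHom n m r U)

lemma app_congr' {V W : Set (EuclideanSpace ℝ (Fin n))} (hV : V ⊆ U) (hVo : IsOpen V)
    (hW : W ⊆ V) (hWo : IsOpen W)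
    {f g : EuclideanSpace ℝ (Fin n) → ℝ} (hf : ContDiffOn ℝ (m : ℕ∞) f V)
    (hg : ContDiffOn ℝ (m : ℕ∞) g V) (h : ∀ x ∈ W, f x = g x) :
    ∀ x ∈ W, u.app V f x = u.app V g x := by
  intro x hx
  rw [u.restrict V hV hVo W hW hWo f g hf (hg.mono hW) h x hx,
    u.restrict V hV hVo W hW hWo g g hg (hg.mono hW) (fun _ _ => rfl) x hx]

lemma app_zero' {V : Set (EuclideanSpace ℝ (Fin n))} (hV : V ⊆ U) (hVo : IsOpen V) :
    ∀ x ∈ V, u.app V (fun _ => 0) x = 0 := by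
  intro x hx
  have h := u.map_smul V hV hVo 0 (fun _ => 0) contDiffOn_const x hx
  have e : ((0 : ℝ) • (fun _ => 0 : EuclideanSpace ℝ (Fin n) → ℝ)) = fun _ => 0 := by
    ext; simp
  rw [e] at h
  simpa using h

lemma app_sum' {V : Set (EuclideanSpace ℝ (Fin n))} (hV : V ⊆ U) (hVo : IsOpen V)
    (S : Finset ℕ) (c : ℕ → ℝ) (f : ℕ → EuclideanSpace ℝ (Fin n) → ℝ)
    (hf : ∀ k, ContDiffOn ℝ (m : ℕ∞) (f k) V) :
    ∀ x ∈ V, u.app V (fun y => ∑ k ∈ S, c k * f k y) x = ∑ k ∈ S, c k * u.app V (f k) x := by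
  intro x hx
  induction S using Finset.induction_on with
  | empty => simpa using u.app_zero' hV hVo x hx
  | insert a S ha ih =>
    have e : (fun y => ∑ k ∈ insert a S, c k * f k y) =
        c a • f a + fun y => ∑ k ∈ S, c k * f k y := by
      ext y; simp [Finset.sum_insert ha]
    rw [e, Finset.sum_insert ha, u.map_add V hV hVo, u.map_smul V hV hVo _ _ (hf a) x hx, ih]
    · exact (hf a).const_smul (c a)
    · exact ContDiffOn.sum fun k _ => contDiffOn_const.mul (hf k)
    · exact hx

end SheafHom

namespace SheafHom
variable {n m : ℕ} {U : Set (EuclideanSpace ℝ (Fin n))} (u : SheafHom n m m U)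

/-- If `f` vanishes on an open set accumulating at `x`, then so does `u f`. -/
lemma app_vanish {V : Set (EuclideanSpace ℝ (Fin n))} (hV : V ⊆ U) (hVo : IsOpen V)
    {W : Set (EuclideanSpace ℝ (Fin n))} (hWo : IsOpen W)
    {f : EuclideanSpace ℝ (Fin n) → ℝ} (hf : ContDiffOn ℝ (m : ℕ∞) f V)
    (h : ∀ x ∈ W, f x = 0) {x : EuclideanSpace ℝ (Fin n)} (hx : x ∈ V)
    (hfr : ∃ᶠ y in 𝓝 x, y ∈ W) : u.app V f x = 0 := by
  have hc : ContinuousAt (u.app V f) x :=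
    (u.map_contDiffOn V hV hVo f hf).continuousOn.continuousAt (hVo.mem_nhds hx)
  refine aux_zero_of_freq hc ?_
  refine (hfr.and_eventually (hVo.mem_nhds hx)).mono ?_
  rintro y ⟨hyW, hyV⟩
  have hs : V ∩ W ⊆ V := Set.inter_subset_left
  rw [u.app_congr' hV hVo hs (hVo.inter hWo) hf contDiffOn_const (g := fun _ => 0)
    (fun z hz => h z hz.2) y ⟨hyV, hyW⟩]
  exact u.app_zero' hV hVo y hyV

/-- The case of nonvanishing differential. -/
lemma app_of_fderiv_ne (hm : 1 ≤ m) {V : Set (EuclideanSpace ℝ (Fin n))} (hV : V ⊆ U)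
    (hVo : IsOpen V) {g : EuclideanSpace ℝ (Fin n) → ℝ} (hg : ContDiffOn ℝ (m : ℕ∞) g V)
    {x v : EuclideanSpace ℝ (Fin n)} (hx : x ∈ V) (hv : fderiv ℝ g x v ≠ 0) :
    u.app V g x = u.app V (fun _ => 1) x * g x := by
  have hm1 : (1 : WithTop ℕ∞) ≤ ((m : ℕ∞) : WithTop ℕ∞) := by exact_mod_cast hm
  have hm0 : ((m : ℕ∞) : WithTop ℕ∞) ≠ 0 := by
    intro h; rw [h] at hm1; simp at hm1
  set ℓ : ℝ → EuclideanSpace ℝ (Fin n) := fun t => x + t • v with hℓ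
  have hℓs : ContDiff ℝ (m : ℕ∞) ℓ := by fun_prop
  have hℓd : ∀ t, HasDerivAt ℓ v t := by
    intro t
    have := ((hasDerivAt_id t).smul_const v).const_add x
    rw [one_smul] at this
    exact this
  set V' : Set (EuclideanSpace ℝ (Fin n)) := V ∩ (fun y => fderiv ℝ g y v) ⁻¹' {0}ᶜ with hV'
  have hV'o : IsOpen V' := by
    have := hg.continuousOn_fderiv_of_isOpen hVo hm1
    exact (this.clm_apply continuousOn_const).isOpen_inter_preimage hVo isOpen_compl_singleton
  set I : Set ℝ := ℓ ⁻¹' V' with hIdef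
  have hI : IsOpen I := hV'o.preimage hℓs.continuous
  have h0I : (0 : ℝ) ∈ I := by
    simp only [hIdef, hV', hℓ, Set.mem_preimage, zero_smul, add_zero]
    exact ⟨hx, hv⟩
  have hIV : ∀ t ∈ I, ℓ t ∈ V := fun t ht => ht.1
  have hcomp : ∀ f : EuclideanSpace ℝ (Fin n) → ℝ, ContDiffOn ℝ (m : ℕ∞) f V → ContDiffOn ℝ (m : ℕ∞) (fun t => f (ℓ t)) I :=
    fun f hf => hf.comp hℓs.contDiffOn hIV
  set p : ℕ → ℝ → ℝ := fun k t => u.app V (fun y => g y ^ k) (ℓ t) with hpdef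
  set γ : ℝ → ℝ := fun t => g (ℓ t) with hγdef
  set γ' : ℝ → ℝ := fun t => fderiv ℝ g (ℓ t) v with hγ'def
  have hp : ∀ k, ContDiffOn ℝ (m : ℕ∞) (p k) I := fun k =>
    hcomp _ (u.map_contDiffOn V hV hVo _ (hg.pow k))
  have hγ : ∀ s ∈ I, HasDerivAt γ (γ' s) s := by
    intro s hs
    have h1 : DifferentiableAt ℝ g (ℓ s) :=
      (hg.differentiableOn hm0).differentiableAt (hVo.mem_nhds (hIV s hs))
    exact h1.hasFDerivAt.comp_hasDerivAt s (hℓd s)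
  have hγ'0 : ∀ s ∈ I, γ' s ≠ 0 := fun s hs => hs.2
  have hQ : ∀ s ∈ I, ∀ j ≤ m, auxQ p γ (m + 1) j s = 0 := by
    intro s hs j hj
    set c := γ s with hc
    set ψ : EuclideanSpace ℝ (Fin n) → ℝ := fun y => (max (g y - c) 0) ^ (m + 1) with hψ
    set θ : EuclideanSpace ℝ (Fin n) → ℝ := fun y => ∑ k ∈ Finset.range (m + 1 + 1),
      (((m + 1).choose k : ℝ) * (-c) ^ (m + 1 - k)) * g y ^ k with hθ
    have hθ' : ∀ y, θ y = (g y - c) ^ (m + 1) := by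
      intro y
      rw [sub_eq_add_neg, add_pow]
      refine Finset.sum_congr rfl fun k _ => by ring
    have hψs : ContDiffOn ℝ (m : ℕ∞) ψ V :=
      (aux_pos_contDiff m).comp_contDiffOn (hg.sub contDiffOn_const)
    have hθs : ContDiffOn ℝ (m : ℕ∞) θ V :=
      ContDiffOn.sum fun k _ => contDiffOn_const.mul (hg.pow k)
    set w : ℝ → ℝ := fun t => u.app V ψ (ℓ t) with hw
    set F : ℝ → ℝ := fun t => u.app V θ (ℓ t) with hF
    have hws : ContDiffOn ℝ (m : ℕ∞) w I := hcomp _ (u.map_contDiffOn V hV hVo _ hψs)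
    have hFs : ContDiffOn ℝ (m : ℕ∞) F I := hcomp _ (u.map_contDiffOn V hV hVo _ hθs)
    have hγc : ContinuousOn γ I := fun t ht => (hγ t ht).continuousAt.continuousWithinAt
    have hlt : ∃ᶠ t in 𝓝 s, γ t < c := by
      intro h
      have : IsLocalMin γ s := h.mono fun t ht => not_lt.1 ht
      exact hγ'0 s hs (this.hasDerivAt_eq_zero (hγ s hs))
    have hgt : ∃ᶠ t in 𝓝 s, c < γ t := by
      intro h
      have : IsLocalMax γ s := h.mono fun t ht => not_lt.1 ht
      exact hγ'0 s hs (this.hasDerivAt_eq_zero (hγ s hs))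
    have hwlt : ∀ t ∈ I, γ t < c → w t = 0 := by
      intro t ht htc
      have hWo : IsOpen (V ∩ g ⁻¹' (Set.Iio c)) :=
        hg.continuousOn.isOpen_inter_preimage hVo isOpen_Iio
      have h1 := u.app_congr' hV hVo Set.inter_subset_left hWo hψs contDiffOn_const
        (g := fun _ => 0) (by
          rintro y ⟨_, hy⟩
          have hy : g y < c := hy
          simp only [hψ]
          rw [max_eq_right (by linarith)]; simp) (ℓ t) ⟨hIV t ht, htc⟩
      exact h1.trans (u.app_zero' hV hVo _ (hIV t ht))
    have hwgt : ∀ t ∈ I, c < γ t → w t = F t := by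
      intro t ht htc
      have hWo : IsOpen (V ∩ g ⁻¹' (Set.Ioi c)) :=
        hg.continuousOn.isOpen_inter_preimage hVo isOpen_Ioi
      exact u.app_congr' hV hVo Set.inter_subset_left hWo hψs hθs (by
          rintro y ⟨_, hy⟩
          have hy : c < g y := hy
          rw [hθ']
          simp only [hψ]
          rw [max_eq_left (by linarith)]) (ℓ t) ⟨hIV t ht, htc⟩
    have hwc := aux_iter_cont hj hI hws hs
    have hFc := aux_iter_cont hj hI hFs hs
    have hw0 : iteratedDeriv j w s = 0 := by
      refine aux_zero_of_freq hwc ((hlt.and_eventually (hI.mem_nhds hs)).mono ?_)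
      rintro t ⟨ht, htI⟩
      have : w =ᶠ[𝓝 t] fun _ => 0 := by
        filter_upwards [(hγc.isOpen_inter_preimage hI isOpen_Iio).mem_nhds ⟨htI, ht⟩] with y hy
        exact hwlt y hy.1 hy.2
      rw [this.iteratedDeriv_eq j, iteratedDeriv_fun_const_zero]
    have hwF : iteratedDeriv j w s - iteratedDeriv j F s = 0 := by
      refine aux_zero_of_freq (h := fun t => iteratedDeriv j w t - iteratedDeriv j F t)
        (hwc.sub hFc) ((hgt.and_eventually (hI.mem_nhds hs)).mono ?_)
      rintro t ⟨ht, htI⟩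
      have : w =ᶠ[𝓝 t] F := by
        filter_upwards [(hγc.isOpen_inter_preimage hI isOpen_Ioi).mem_nhds ⟨htI, ht⟩] with y hy
        exact hwgt y hy.1 hy.2
      rw [this.iteratedDeriv_eq j, sub_self]
    have hF0 : iteratedDeriv j F s = 0 := by linarith
    have hFe : F =ᶠ[𝓝 s] fun t => ∑ k ∈ Finset.range (m + 1 + 1),
        (((m + 1).choose k : ℝ) * (-c) ^ (m + 1 - k)) * p k t := by
      filter_upwards [hI.mem_nhds hs] with t ht
      exact u.app_sum' hV hVo _ _ (fun k y => g y ^ k) (fun k => hg.pow k) (ℓ t) (hIV t ht)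
    have hps : ∀ k, ContDiffAt ℝ j (p k) s := fun k =>
      ((hp k).contDiffAt (hI.mem_nhds hs)).of_le (by exact_mod_cast hj)
    rw [hFe.iteratedDeriv_eq j, iteratedDeriv_fun_sum
      (fun k _ => contDiffAt_const.mul (hps k))] at hF0
    rw [auxQ, ← hF0]
    refine Finset.sum_congr rfl fun k _ => ?_
    rw [iteratedDeriv_const_mul_field, mul_assoc]
  have hfin := auxQ_zero hI hp hγ hγ'0 hQ m le_rfl 0 h0I 0 (by omega)
  have e : m + 1 - m = 1 := by omega
  rw [e] at hfin
  simp [auxQ, Finset.sum_range_succ, hpdef, hγdef, hℓ] at hfin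
  linarith

lemma app_eq_of_pos (hn : 1 ≤ n) (hm : 1 ≤ m) {V : Set (EuclideanSpace ℝ (Fin n))} (hV : V ⊆ U)
    (hVo : IsOpen V) {g : EuclideanSpace ℝ (Fin n) → ℝ} (hg : ContDiffOn ℝ (m : ℕ∞) g V)
    {x : EuclideanSpace ℝ (Fin n)} (hx : x ∈ V) :
    u.app V g x = u.app V (fun _ => 1) x * g x := by
  set v : EuclideanSpace ℝ (Fin n) := EuclideanSpace.single ⟨0, hn⟩ 1
  have hm0 : ((m : ℕ∞) : WithTop ℕ∞) ≠ 0 := by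
    intro h
    have : m = 0 := by exact_mod_cast h
    omega
  by_cases h : fderiv ℝ g x v = 0
  · set l : EuclideanSpace ℝ (Fin n) → ℝ := fun y => EuclideanSpace.proj (𝕜 := ℝ) ⟨0, hn⟩ y
    have hl : ContDiff ℝ (m : ℕ∞) l := ContinuousLinearMap.contDiff _
    have hld : HasFDerivAt l (EuclideanSpace.proj (𝕜 := ℝ) (⟨0, hn⟩ : Fin n)) x :=
      ContinuousLinearMap.hasFDerivAt _
    have hgd : HasFDerivAt g (fderiv ℝ g x) x :=
      ((hg.differentiableOn hm0).differentiableAt (hVo.mem_nhds hx)).hasFDerivAt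
    have hl1 : fderiv ℝ l x v ≠ 0 := by
      rw [hld.fderiv]; simp [v]
    have hl2 : fderiv ℝ (g + l) x v ≠ 0 := by
      rw [(hgd.add hld).fderiv, _root_.add_apply, h]; simp [v]
    have e1 := u.app_of_fderiv_ne hm hV hVo hl.contDiffOn hx hl1
    have e2 := u.app_of_fderiv_ne hm hV hVo (hg.add hl.contDiffOn) hx hl2
    have e3 := u.map_add V hV hVo g l hg hl.contDiffOn x hx
    change u.app V (g + l) x = u.app V (fun _ => 1) x * (g x + l x) at e2
    linarith
  · exact u.app_of_fderiv_ne hm hV hVo hg hx h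

end SheafHom

namespace SheafHom
variable {n : ℕ} {U : Set (EuclideanSpace ℝ (Fin n))}

lemma app_zero_of_zero (u : SheafHom n 0 0 U) (hn : 1 ≤ n)
    {V : Set (EuclideanSpace ℝ (Fin n))} (hV : V ⊆ U)
    (hVo : IsOpen V) {f : EuclideanSpace ℝ (Fin n) → ℝ} (hf : ContinuousOn f V)
    {x : EuclideanSpace ℝ (Fin n)} (hx : x ∈ V) (hfx : f x = 0) :
    u.app V f x = 0 := by
  have hC : ∀ h : EuclideanSpace ℝ (Fin n) → ℝ, ContinuousOn h V →
      ContDiffOn ℝ ((0 : ℕ) : ℕ∞) h V := by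
    intro h hh
    simpa using (contDiffOn_zero (𝕜 := ℝ)).2 hh
  set a : EuclideanSpace ℝ (Fin n) → ℝ := fun y => (y - x) ⟨0, hn⟩ with ha
  have hac : Continuous a := by fun_prop
  set v : EuclideanSpace ℝ (Fin n) := EuclideanSpace.single ⟨0, hn⟩ 1 with hv
  have hav : ∀ t : ℝ, a (x + t • v) = t := by intro t; simp [ha, hv]
  have hvn : ∀ t : ℝ, ‖(x + t • v) - x‖ = |t| := by intro t; simp [hv, norm_smul]
  set χ : EuclideanSpace ℝ (Fin n) → ℝ := fun y => max 0 (min 1 (2 * a y / ‖y - x‖)) with hχ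
  have hχ0 : ∀ y, 0 ≤ χ y := fun y => le_max_left _ _
  have hχ1 : ∀ y, χ y ≤ 1 := fun y => max_le zero_le_one (min_le_left _ _)
  have hχc : ContinuousOn (fun y => χ y * f y) V := by
    intro y hy
    by_cases hyx : y = x
    · subst hyx
      have hfc := hf y hy
      unfold ContinuousWithinAt at hfc ⊢
      rw [hfx] at hfc
      simp only [hfx, mul_zero]
      refine squeeze_zero_norm (fun z => ?_) (by simpa using hfc.norm)
      rw [norm_mul, Real.norm_eq_abs, abs_of_nonneg (hχ0 z)]
      exact mul_le_of_le_one_left (norm_nonneg _) (hχ1 z)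
    · have hne : ‖y - x‖ ≠ 0 := by simpa [sub_eq_zero] using hyx
      have : ContinuousAt χ y := by
        have h1 : ContinuousAt (fun y => 2 * a y / ‖y - x‖) y :=
          ContinuousAt.div (by fun_prop) (by fun_prop) hne
        exact continuousAt_const.max (continuousAt_const.min h1)
      exact this.continuousWithinAt.mul (hf y hy)
  have hχc2 : ContinuousOn (fun y => f y - χ y * f y) V := hf.sub hχc
  have htend : Tendsto (fun t : ℝ => x + t • v) (𝓝 0) (𝓝 x) := by
    have : Continuous (fun t : ℝ => x + t • v) := by fun_prop
    simpa using this.tendsto 0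
  have hfrlt : ∃ᶠ t : ℝ in 𝓝 0, t < 0 :=
    Frequently.filter_mono (Eventually.frequently (f := 𝓝[<] (0 : ℝ))
      self_mem_nhdsWithin) nhdsWithin_le_nhds
  have hfrgt : ∃ᶠ t : ℝ in 𝓝 0, 0 < t :=
    Frequently.filter_mono (Eventually.frequently (f := 𝓝[>] (0 : ℝ))
      self_mem_nhdsWithin) nhdsWithin_le_nhds
  have e1 : u.app V (fun y => χ y * f y) x = 0 := by
    refine u.app_vanish hV hVo (W := {y | a y < 0}) (isOpen_lt hac continuous_const)
      (hC _ hχc) ?_ hx ?_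
    · intro y hy
      have hy : a y < 0 := hy
      have : 2 * a y / ‖y - x‖ ≤ 0 := div_nonpos_of_nonpos_of_nonneg (by linarith) (norm_nonneg _)
      have : χ y = 0 := max_eq_left ((min_le_right _ _).trans this)
      simp [this]
    · refine htend.frequently (hfrlt.mono fun t ht => ?_)
      simpa [hav] using ht
  have e2 : u.app V (fun y => f y - χ y * f y) x = 0 := by
    refine u.app_vanish hV hVo (W := {y | ‖y - x‖ < 2 * a y})
      (isOpen_lt (by fun_prop) (by fun_prop)) (hC _ hχc2) ?_ hx ?_
    · intro y hy
      have hy : ‖y - x‖ < 2 * a y := hy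
      by_cases hyx : y = x
      · subst hyx; simp [hfx]
      · have hne : 0 < ‖y - x‖ := by simpa [sub_eq_zero] using hyx
        have : 1 ≤ 2 * a y / ‖y - x‖ := by rw [le_div_iff₀ hne]; linarith
        have : χ y = 1 := by simp only [hχ]; rw [min_eq_left this]; simp
        simp [this]
    · refine htend.frequently (hfrgt.mono fun t ht => ?_)
      change ‖x + t • v - x‖ < 2 * a (x + t • v)
      rw [hav, hvn, abs_of_pos ht]; linarith
  have e3 := u.map_add V hV hVo _ _ (hC _ hχc) (hC _ hχc2) x hx
  have e4 : ((fun y => χ y * f y) + fun y => f y - χ y * f y) = f := by ext y; simp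
  rw [e4] at e3
  linarith

lemma app_eq (m : ℕ) (u : SheafHom n m m U) (hn : 1 ≤ n)
    {V : Set (EuclideanSpace ℝ (Fin n))} (hV : V ⊆ U)
    (hVo : IsOpen V) {f : EuclideanSpace ℝ (Fin n) → ℝ} (hf : ContDiffOn ℝ (m : ℕ∞) f V)
    {x : EuclideanSpace ℝ (Fin n)} (hx : x ∈ V) :
    u.app V f x = u.app V (fun _ => 1) x * f x := by
  rcases Nat.eq_zero_or_pos m with rfl | hm
  · have h1 : ContDiffOn ℝ ((0 : ℕ) : ℕ∞) ((-f x) • (fun _ => 1 : EuclideanSpace ℝ (Fin n) → ℝ)) V :=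
      contDiffOn_const.const_smul (-f x)
    have e1 := u.map_add V hV hVo f _ hf h1 x hx
    have e2 := u.map_smul V hV hVo (-f x) (fun _ => 1) contDiffOn_const x hx
    have e3 := u.app_zero_of_zero hn hV hVo (hf.add h1).continuousOn hx (by simp)
    have e3' : u.app V (f + (-f x) • (fun _ => 1 : EuclideanSpace ℝ (Fin n) → ℝ)) x = 0 := e3
    rw [e3', e2] at e1
    linarith
  · exact u.app_eq_of_pos hn hm hV hVo hf hx

end SheafHom

/-- Every morphism of sheaves `u : C^m → C^m` over a nonempty open `U ⊆ ℝⁿ` is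
multiplication by a unique function `g ∈ C^m(U)`: `Hom(C^m, C^m) ≃ C^m`. -/
theorem stmt_10 (n m : ℕ) (hn : 1 ≤ n)
    (U : Set (EuclideanSpace ℝ (Fin n))) (hU : IsOpen U) (hUne : U.Nonempty)
    (u : SheafHom n m m U) :
    ∃ g : EuclideanSpace ℝ (Fin n) → ℝ,
      (ContDiffOn ℝ (m : ℕ∞) g U ∧
        ∀ V, V ⊆ U → IsOpen V → ∀ φ, ContDiffOn ℝ (m : ℕ∞) φ V → ∀ x ∈ V,
          u.app V φ x = g x * φ x) ∧
      ∀ g' : EuclideanSpace ℝ (Fin n) → ℝ,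
        (ContDiffOn ℝ (m : ℕ∞) g' U ∧
          ∀ V, V ⊆ U → IsOpen V → ∀ φ, ContDiffOn ℝ (m : ℕ∞) φ V → ∀ x ∈ V,
            u.app V φ x = g' x * φ x) →
        ∀ x ∈ U, g' x = g x := by
  refine ⟨u.app U (fun _ => 1), ⟨u.map_contDiffOn U subset_rfl hU _ contDiffOn_const, ?_⟩, ?_⟩
  · intro V hV hVo φ hφ x hx
    rw [u.app_eq m hn hV hVo hφ hx,
      u.restrict U subset_rfl hU V hV hVo (fun _ => 1) (fun _ => 1) contDiffOn_const
        contDiffOn_const (fun _ _ => rfl) x hx]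
  · rintro g' ⟨_, h⟩ x hx
    simpa using (h U subset_rfl hU (fun _ => 1) contDiffOn_const x hx).symm
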